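/- arXiv:1402.5375 — 3 statements merged into one kernel-verified Lean document; each statement's English description precedes it below -/
import Mathlib

section
/- Let Ω ⊂ ℝ² be a bounded open set, let φ, ψ : ℝ² → ℝ be smooth, and let η : ℝ² → ℝ be smooth with compact support contained in Ω. Then the function s ↦ E[φ, ψ + sη] is differentiable at s = 0 with derivative d/ds E[φ, ψ + sη]|_{s=0} = ∫_Ω (δE/δψ) η dx, where δE/δψ = −γ₂( ε₂ Δψ − (1/ε₂)(ψ²−1)ψ ) + γ₁((ψ−1)/2)( (ε₁/2)|∇φ|² + (1/(4ε₁))(φ²−1)² ). -/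
open MeasureTheory

/-- Partial derivative in the `i`-th coordinate direction. -/
noncomputable def pd (i : Fin 2) (f : (Fin 2 → ℝ) → ℝ) (x : Fin 2 → ℝ) : ℝ :=
  fderiv ℝ f x (Pi.single i 1)

/-- The mixing energy density
`W = γ₁((ψ−1)/2)²((ε₁/2)|∇φ|² + (1/(4ε₁))(φ²−1)²) + γ₂((ε₂/2)|∇ψ|² + (1/(4ε₂))(ψ²−1)²)`. -/
noncomputable def W (γ1 γ2 ε1 ε2 : ℝ) (φ ψ : (Fin 2 → ℝ) → ℝ) (x : Fin 2 → ℝ) : ℝ :=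
  γ1 * ((ψ x - 1) / 2) ^ 2 *
      ((ε1 / 2) * ∑ j, (pd j φ x) ^ 2 + (1 / (4 * ε1)) * ((φ x) ^ 2 - 1) ^ 2)
  + γ2 * ((ε2 / 2) * ∑ j, (pd j ψ x) ^ 2 + (1 / (4 * ε2)) * ((ψ x) ^ 2 - 1) ^ 2)

theorem pd_contDiff (j : Fin 2) {f : (Fin 2 → ℝ) → ℝ} (hf : ContDiff ℝ (⊤ : ℕ∞) f) :
    ContDiff ℝ (⊤ : ℕ∞) (pd j f) := by
  unfold pd
  exact (hf.fderiv_right (m := (⊤ : ℕ∞)) (by simp)).clm_apply contDiff_const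

theorem pd_add_smul (j : Fin 2) {f g : (Fin 2 → ℝ) → ℝ} (hf : ContDiff ℝ (⊤ : ℕ∞) f)
    (hg : ContDiff ℝ (⊤ : ℕ∞) g) (s : ℝ) (x : Fin 2 → ℝ) :
    pd j (fun y => f y + s * g y) x = pd j f x + s * pd j g x := by
  have hf' : DifferentiableAt ℝ f x := hf.differentiable (by simp) x
  have hg' : DifferentiableAt ℝ g x := hg.differentiable (by simp) x
  unfold pd
  have h := (hf'.hasFDerivAt.add (hg'.hasFDerivAt.const_mul s)).fderiv
  have e : (fun y => f y + s * g y) = (f + fun y => s * g y) := rfl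
  rw [e, h]
  simp

theorem ibp_pd (j : Fin 2) {Ω : Set (Fin 2 → ℝ)} {p η : (Fin 2 → ℝ) → ℝ}
    (hp : ContDiff ℝ (⊤ : ℕ∞) p) (hη : ContDiff ℝ (⊤ : ℕ∞) η)
    (hηc : HasCompactSupport η) (hηs : tsupport η ⊆ Ω) :
    ∫ x in Ω, p x * pd j η x = - ∫ x in Ω, pd j p x * η x := by
  have hq0 : ∀ x, x ∉ Ω → pd j η x = 0 := by
    intro x hx
    have : fderiv ℝ η x = 0 := by
      by_contra hne
      exact hx (hηs (support_fderiv_subset ℝ hne))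
    simp [pd, this]
  have hqc : HasCompactSupport (pd j η) := by
    unfold pd
    exact hηc.fderiv_apply ℝ (Pi.single j 1)
  have hη0 : ∀ x, x ∉ Ω → η x = 0 := by
    intro x hx
    exact image_eq_zero_of_notMem_tsupport (fun h => hx (hηs h))
  rw [setIntegral_eq_integral_of_forall_compl_eq_zero (fun x hx => by simp [hq0 x hx]),
    setIntegral_eq_integral_of_forall_compl_eq_zero (fun x hx => by simp [hη0 x hx])]
  have cp := hp.continuous
  have ce := hη.continuous
  have cdp := (pd_contDiff j hp).continuous
  have cde := (pd_contDiff j hη).continuous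
  exact integral_mul_fderiv_eq_neg_fderiv_mul_of_integrable
    ((cdp.mul ce).integrable_of_hasCompactSupport hηc.mul_left)
    ((cp.mul cde).integrable_of_hasCompactSupport hqc.mul_left)
    ((cp.mul ce).integrable_of_hasCompactSupport hηc.mul_left)
    (fun x _ => hp.differentiable (by simp) x) (fun x _ => hη.differentiable (by simp) x)

theorem cont_intOn {Ω : Set (Fin 2 → ℝ)} (hΩb : Bornology.IsBounded Ω)
    {f : (Fin 2 → ℝ) → ℝ} (hf : Continuous f) : Integrable f (volume.restrict Ω) :=
  (hf.continuousOn.integrableOn_compact hΩb.isCompact_closure).mono_set subset_closure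

theorem poly_deriv {Ω : Set (Fin 2 → ℝ)} {F : ℝ → (Fin 2 → ℝ) → ℝ}
    {A0 A1 A2 A3 A4 : (Fin 2 → ℝ) → ℝ} (h0 : Integrable A0 (volume.restrict Ω))
    (h1 : Integrable A1 (volume.restrict Ω)) (h2 : Integrable A2 (volume.restrict Ω))
    (h3 : Integrable A3 (volume.restrict Ω)) (h4 : Integrable A4 (volume.restrict Ω))
    (hF : ∀ s x, F s x = A0 x + s * A1 x + s ^ 2 * A2 x + s ^ 3 * A3 x + s ^ 4 * A4 x) :
    HasDerivAt (fun s => ∫ x in Ω, F s x) (∫ x in Ω, A1 x) 0 := by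
  have e : (fun s => ∫ x in Ω, F s x) = fun s => (∫ x in Ω, A0 x) + s * (∫ x in Ω, A1 x)
      + s ^ 2 * (∫ x in Ω, A2 x) + s ^ 3 * (∫ x in Ω, A3 x) + s ^ 4 * (∫ x in Ω, A4 x) := by
    funext s
    simp_rw [hF]
    rw [integral_add (by fun_prop) (by fun_prop), integral_add (by fun_prop) (by fun_prop),
      integral_add (by fun_prop) (by fun_prop), integral_add (by fun_prop) (by fun_prop)]
    simp only [integral_const_mul]
  rw [e]
  generalize (∫ x in Ω, A0 x) = a0
  generalize (∫ x in Ω, A1 x) = a1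
  generalize (∫ x in Ω, A2 x) = a2
  generalize (∫ x in Ω, A3 x) = a3
  generalize (∫ x in Ω, A4 x) = a4
  have h := (((((hasDerivAt_id (0 : ℝ)).mul_const a1).const_add a0).add
    (((hasDerivAt_id (0 : ℝ)).pow 2).mul_const a2)).add
    (((hasDerivAt_id (0 : ℝ)).pow 3).mul_const a3)).add
    (((hasDerivAt_id (0 : ℝ)).pow 4).mul_const a4)
  refine (h.congr_deriv (by simp)).congr_of_eventuallyEq (Filter.Eventually.of_forall fun s => ?_)
  simp

/-- First variation of the mixing energy with respect to `ψ`: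
`d/ds E[φ, ψ + sη]|₀ = ∫_Ω (δE/δψ) η dx` with
`δE/δψ = −γ₂(ε₂Δψ − (1/ε₂)(ψ²−1)ψ) + γ₁((ψ−1)/2)((ε₁/2)|∇φ|² + (1/(4ε₁))(φ²−1)²)`. -/
theorem stmt3 (γ1 γ2 ε1 ε2 : ℝ) (hγ1 : 0 < γ1) (hγ2 : 0 < γ2) (hε1 : 0 < ε1) (hε2 : 0 < ε2)
    (Ω : Set (Fin 2 → ℝ)) (hΩo : IsOpen Ω) (hΩb : Bornology.IsBounded Ω)
    (φ ψ η : (Fin 2 → ℝ) → ℝ)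
    (hφ : ContDiff ℝ (⊤ : ℕ∞) φ) (hψ : ContDiff ℝ (⊤ : ℕ∞) ψ) (hη : ContDiff ℝ (⊤ : ℕ∞) η)
    (hηc : HasCompactSupport η) (hηs : tsupport η ⊆ Ω) :
    HasDerivAt (fun s : ℝ => ∫ x in Ω, W γ1 γ2 ε1 ε2 φ (fun y => ψ y + s * η y) x)
      (∫ x in Ω,
        (-γ2 * (ε2 * (∑ j, pd j (fun y => pd j ψ y) x)
              - (1 / ε2) * ((ψ x) ^ 2 - 1) * ψ x)
          + γ1 * ((ψ x - 1) / 2) *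
              ((ε1 / 2) * ∑ j, (pd j φ x) ^ 2 + (1 / (4 * ε1)) * ((φ x) ^ 2 - 1) ^ 2)) * η x)
      0 := by
  have cφ := hφ.continuous
  have cψ := hψ.continuous
  have cη := hη.continuous
  have dφ := fun j => (pd_contDiff j hφ).continuous
  have dψ := fun j => (pd_contDiff j hψ).continuous
  have dη := fun j => (pd_contDiff j hη).continuous
  have ddψ := fun j => (pd_contDiff j (pd_contDiff j hψ)).continuous
  set P : (Fin 2 → ℝ) → ℝ := fun x =>
    (ε1 / 2) * ∑ j, (pd j φ x) ^ 2 + (1 / (4 * ε1)) * ((φ x) ^ 2 - 1) ^ 2 with hP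
  have cP : Continuous P := by fun_prop
  set B : (Fin 2 → ℝ) → ℝ := fun x =>
    γ1 * ((ψ x - 1) / 2) * P x * η x + γ2 * ((1 / ε2) * ((ψ x) ^ 2 - 1) * ψ x * η x) with hB
  have cB : Continuous B := by fun_prop
  have key := poly_deriv (Ω := Ω)
    (F := fun s x => W γ1 γ2 ε1 ε2 φ (fun y => ψ y + s * η y) x)
    (A0 := fun x => γ1 * ((ψ x - 1) / 2) ^ 2 * P x
      + γ2 * ((ε2 / 2) * ∑ j, (pd j ψ x) ^ 2 + (1 / (4 * ε2)) * ((ψ x) ^ 2 - 1) ^ 2))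
    (A1 := fun x => B x + (γ2 * ε2) * (pd 0 ψ x * pd 0 η x) + (γ2 * ε2) * (pd 1 ψ x * pd 1 η x))
    (A2 := fun x => γ1 / 4 * (η x) ^ 2 * P x + γ2 * ((ε2 / 2) * ∑ j, (pd j η x) ^ 2
      + (1 / (4 * ε2)) * (6 * (ψ x) ^ 2 - 2) * (η x) ^ 2))
    (A3 := fun x => γ2 * (1 / ε2) * ψ x * (η x) ^ 3)
    (A4 := fun x => γ2 * (1 / (4 * ε2)) * (η x) ^ 4)
    (cont_intOn hΩb (by fun_prop)) (cont_intOn hΩb (by fun_prop)) (cont_intOn hΩb (by fun_prop))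
    (cont_intOn hΩb (by fun_prop)) (cont_intOn hΩb (by fun_prop))
    (by
      intro s x
      simp only [W, pd_add_smul _ hψ hη, hP, hB, Fin.sum_univ_two]
      field_simp
      ring)
  refine key.congr_deriv ?_
  have iB := cont_intOn hΩb cB
  have i1 : ∀ j, Integrable (fun x => (γ2 * ε2) * (pd j ψ x * pd j η x)) (volume.restrict Ω) :=
    fun j => cont_intOn hΩb (by fun_prop)
  have i2 : ∀ j, Integrable (fun x => (-(γ2 * ε2)) * (pd j (pd j ψ) x * η x))
      (volume.restrict Ω) :=
    fun j => cont_intOn hΩb (by fun_prop)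
  have I : ∀ j, ∫ x in Ω, (γ2 * ε2) * (pd j ψ x * pd j η x)
      = ∫ x in Ω, (-(γ2 * ε2)) * (pd j (pd j ψ) x * η x) := by
    intro j
    rw [integral_const_mul, integral_const_mul, ibp_pd j (pd_contDiff j hψ) hη hηc hηs]
    ring
  have i3 : Integrable (fun x => B x + (γ2 * ε2) * (pd 0 ψ x * pd 0 η x)) (volume.restrict Ω) :=
    iB.add (i1 0)
  have i4 : Integrable (fun x => B x + (-(γ2 * ε2)) * (pd 0 (pd 0 ψ) x * η x))
      (volume.restrict Ω) :=
    iB.add (i2 0)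
  rw [integral_add i3 (i1 1), integral_add iB (i1 0), I 0, I 1,
    ← integral_add iB (i2 0), ← integral_add i4 (i2 1)]
  congr 1
  funext x
  simp only [hB, hP, Fin.sum_univ_two]
  change _ = (-γ2 * (ε2 * (pd 0 (pd 0 ψ) x + pd 1 (pd 1 ψ) x) - _) + _) * _
  ring
end

section
/- Let Ω ⊂ ℝ² be a bounded open set, let φ, ψ : ℝ² → ℝ be smooth, and let v : ℝ² → ℝ² be a smooth vector field with compact support contained in Ω satisfying ∇·v = 0. Then the first variation of the mixing energy under the transport variations δφ = −v·∇φ and δψ = −v·∇ψ equals the virtual work of the elastic stress: d/ds E[φ − s v·∇φ, ψ − s v·∇ψ]|_{s=0} = ∫_Ω σ̃ᵉ : ∇v dx, where σ̃ᵉ = −γ₁ε₁((ψ−1)/2)² ∇φ⊗∇φ − γ₂ε₂ ∇ψ⊗∇ψ. Equivalently, d/ds E[φ − s v·∇φ, ψ − s v·∇ψ]|_{s=0} = −∫_Ω ( γ₁ε₁((ψ−1)/2)² ∇φ⊗∇φ + γ₂ε₂ ∇ψ⊗∇ψ ) : ∇v dx. -/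
open MeasureTheory

/-- scalar form of the energy density -/
noncomputable def wf (γ1 γ2 ε1 ε2 P Q p0 p1 q0 q1 : ℝ) : ℝ :=
  γ1 * ((Q - 1) / 2) ^ 2 *
      ((ε1 / 2) * (p0 ^ 2 + p1 ^ 2) + (1 / (4 * ε1)) * (P ^ 2 - 1) ^ 2)
  + γ2 * ((ε2 / 2) * (q0 ^ 2 + q1 ^ 2) + (1 / (4 * ε2)) * (Q ^ 2 - 1) ^ 2)

/-- differential of the scalar form of the energy density -/
noncomputable def wd (γ1 γ2 ε1 ε2 P Q p0 p1 q0 q1 P' Q' p0' p1' q0' q1' : ℝ) : ℝ :=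
  γ1 * (((Q - 1) / 2) * Q') *
      ((ε1 / 2) * (p0 ^ 2 + p1 ^ 2) + (1 / (4 * ε1)) * (P ^ 2 - 1) ^ 2)
  + γ1 * ((Q - 1) / 2) ^ 2 *
      (ε1 * (p0 * p0' + p1 * p1') + (1 / (4 * ε1)) * (4 * (P ^ 2 - 1) * P * P'))
  + γ2 * (ε2 * (q0 * q0' + q1 * q1') + (1 / (4 * ε2)) * (4 * (Q ^ 2 - 1) * Q * Q'))

lemma wf_hasDerivAt (γ1 γ2 ε1 ε2 : ℝ) {P Q p0 p1 q0 q1 : ℝ → ℝ}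
    {P' Q' p0' p1' q0' q1' t : ℝ}
    (hP : HasDerivAt P P' t) (hQ : HasDerivAt Q Q' t)
    (hp0 : HasDerivAt p0 p0' t) (hp1 : HasDerivAt p1 p1' t)
    (hq0 : HasDerivAt q0 q0' t) (hq1 : HasDerivAt q1 q1' t) :
    HasDerivAt (fun s => wf γ1 γ2 ε1 ε2 (P s) (Q s) (p0 s) (p1 s) (q0 s) (q1 s))
      (wd γ1 γ2 ε1 ε2 (P t) (Q t) (p0 t) (p1 t) (q0 t) (q1 t) P' Q' p0' p1' q0' q1') t := by
  unfold wf wd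
  have h1 := (((hQ.sub_const 1).div_const 2).fun_pow 2).const_mul γ1
  have h2 := (((hp0.fun_pow 2).fun_add (hp1.fun_pow 2)).const_mul (ε1 / 2)).fun_add
    ((((hP.fun_pow 2).sub_const 1).fun_pow 2).const_mul (1 / (4 * ε1)))
  have h3 := ((((hq0.fun_pow 2).fun_add (hq1.fun_pow 2)).const_mul (ε2 / 2)).fun_add
    ((((hQ.fun_pow 2).sub_const 1).fun_pow 2).const_mul (1 / (4 * ε2)))).const_mul γ2
  refine ((h1.fun_mul h2).fun_add h3).congr_deriv ?_
  simp only [Nat.cast_ofNat, Nat.add_one_sub_one, pow_one]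
  ring

lemma W_eq (γ1 γ2 ε1 ε2 : ℝ) (φ ψ : (Fin 2 → ℝ) → ℝ) (x : Fin 2 → ℝ) :
    W γ1 γ2 ε1 ε2 φ ψ x
      = wf γ1 γ2 ε1 ε2 (φ x) (ψ x) (pd 0 φ x) (pd 1 φ x) (pd 0 ψ x) (pd 1 ψ x) := by
  simp [W, wf, Fin.sum_univ_two]

lemma pd_smooth {f : (Fin 2 → ℝ) → ℝ} (hf : ContDiff ℝ (⊤ : ℕ∞) f) (i : Fin 2) :
    ContDiff ℝ (⊤ : ℕ∞) (pd i f) :=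
  (hf.fderiv_right (m := (⊤ : ℕ∞)) (by simp)).clm_apply contDiff_const

lemma sm_diff {f : (Fin 2 → ℝ) → ℝ} (hf : ContDiff ℝ (⊤ : ℕ∞) f) : Differentiable ℝ f :=
  hf.differentiable (by simp)

lemma pd_symm {f : (Fin 2 → ℝ) → ℝ} (hf : ContDiff ℝ (⊤ : ℕ∞) f) (i j : Fin 2)
    (x : Fin 2 → ℝ) : pd i (pd j f) x = pd j (pd i f) x := by
  have hd : DifferentiableAt ℝ (fderiv ℝ f) x :=
    ((hf.fderiv_right (m := (⊤ : ℕ∞)) (by simp)).differentiable (by simp)) x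
  have key : ∀ a b : Fin 2, pd a (pd b f) x
      = fderiv ℝ (fderiv ℝ f) x (Pi.single a 1) (Pi.single b 1) := by
    intro a b
    have := (hd.hasFDerivAt.clm_apply
      (hasFDerivAt_const (Pi.single b (1 : ℝ) : Fin 2 → ℝ) x)).fderiv
    unfold pd
    rw [this]
    simp
  rw [key, key]
  exact (hf.contDiffAt.isSymmSndFDerivAt (by
    simp only [minSmoothness_of_isRCLikeNormedField]
    exact WithTop.coe_le_coe.2 (le_top : (2 : ℕ∞) ≤ ⊤))) _ _

lemma pd_line {f : (Fin 2 → ℝ) → ℝ} (hf : ContDiff ℝ (⊤ : ℕ∞) f) (i : Fin 2)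
    (x : Fin 2 → ℝ) :
    HasDerivAt (fun t : ℝ => f (x + t • (Pi.single i (1 : ℝ) : Fin 2 → ℝ))) (pd i f x) 0 :=
  ((sm_diff hf x).hasFDerivAt.hasLineDerivAt (Pi.single i 1))

lemma pd_sub_mul {f g : (Fin 2 → ℝ) → ℝ} (hf : ContDiff ℝ (⊤ : ℕ∞) f)
    (hg : ContDiff ℝ (⊤ : ℕ∞) g) (s : ℝ) (i : Fin 2) (x : Fin 2 → ℝ) :
    pd i (fun y => f y - s * g y) x = pd i f x - s * pd i g x := by
  have h := (sm_diff hf x).hasFDerivAt.fun_sub ((sm_diff hg x).hasFDerivAt.const_mul s)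
  unfold pd
  rw [h.fderiv]
  simp

lemma pd_transport {f : (Fin 2 → ℝ) → ℝ} {v : (Fin 2 → ℝ) → (Fin 2 → ℝ)}
    (hf : ContDiff ℝ (⊤ : ℕ∞) f) (hv : ∀ j, ContDiff ℝ (⊤ : ℕ∞) (fun y => v y j))
    (i : Fin 2) (x : Fin 2 → ℝ) :
    pd i (fun y => ∑ j, v y j * pd j f y) x
      = (pd i (fun y => v y 0) x * pd 0 f x + v x 0 * pd 0 (pd i f) x)
        + (pd i (fun y => v y 1) x * pd 1 f x + v x 1 * pd 1 (pd i f) x) := by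
  simp only [Fin.sum_univ_two]
  have h0 := (sm_diff (hv 0) x).hasFDerivAt.fun_mul (sm_diff (pd_smooth hf 0) x).hasFDerivAt
  have h1 := (sm_diff (hv 1) x).hasFDerivAt.fun_mul (sm_diff (pd_smooth hf 1) x).hasFDerivAt
  rw [pd_symm hf 0 i, pd_symm hf 1 i]
  unfold pd at h0 h1 ⊢
  rw [(h0.fun_add h1).fderiv]
  simp
  ring

lemma W_smooth (γ1 γ2 ε1 ε2 : ℝ) {φ ψ : (Fin 2 → ℝ) → ℝ}
    (hφ : ContDiff ℝ (⊤ : ℕ∞) φ) (hψ : ContDiff ℝ (⊤ : ℕ∞) ψ) :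
    ContDiff ℝ (⊤ : ℕ∞) (W γ1 γ2 ε1 ε2 φ ψ) := by
  have e : W γ1 γ2 ε1 ε2 φ ψ = fun x => _ := funext (W_eq γ1 γ2 ε1 ε2 φ ψ)
  rw [e]
  have := pd_smooth hφ 0
  have := pd_smooth hφ 1
  have := pd_smooth hψ 0
  have := pd_smooth hψ 1
  unfold wf
  fun_prop

lemma pd_W (γ1 γ2 ε1 ε2 : ℝ) {φ ψ : (Fin 2 → ℝ) → ℝ}
    (hφ : ContDiff ℝ (⊤ : ℕ∞) φ) (hψ : ContDiff ℝ (⊤ : ℕ∞) ψ) (k : Fin 2) (x : Fin 2 → ℝ) :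
    pd k (W γ1 γ2 ε1 ε2 φ ψ) x
      = wd γ1 γ2 ε1 ε2 (φ x) (ψ x) (pd 0 φ x) (pd 1 φ x) (pd 0 ψ x) (pd 1 ψ x)
        (pd k φ x) (pd k ψ x) (pd k (pd 0 φ) x) (pd k (pd 1 φ) x)
        (pd k (pd 0 ψ) x) (pd k (pd 1 ψ) x) := by
  have h1 := pd_line (W_smooth γ1 γ2 ε1 ε2 hφ hψ) k x
  have h2 := wf_hasDerivAt γ1 γ2 ε1 ε2 (pd_line hφ k x) (pd_line hψ k x)
    (pd_line (pd_smooth hφ 0) k x) (pd_line (pd_smooth hφ 1) k x)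
    (pd_line (pd_smooth hψ 0) k x) (pd_line (pd_smooth hψ 1) k x)
  simp only [W_eq] at h1
  have := h1.unique h2
  simpa using this

/-- The transport term integrates to zero. -/
lemma transport_zero {w : (Fin 2 → ℝ) → ℝ} {v : (Fin 2 → ℝ) → (Fin 2 → ℝ)}
    (hw : ContDiff ℝ (⊤ : ℕ∞) w) (hv : ∀ j, ContDiff ℝ (⊤ : ℕ∞) (fun y => v y j))
    (hvc : HasCompactSupport v) 
    (hdiv : ∀ x, ∑ j, pd j (fun y => v y j) x = 0) :
    ∫ x, ∑ k, v x k * pd k w x = 0 := by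
  have hc : ∀ k, HasCompactSupport (fun y => v y k) := fun k =>
    hvc.comp_left (g := fun z : Fin 2 → ℝ => z k) rfl
  have hc' : ∀ k, HasCompactSupport (pd k (fun y => v y k)) := fun k =>
    (hc k).fderiv_apply ℝ (Pi.single k 1)
  have i1 : ∀ k, Integrable (fun x => v x k * pd k w x) := fun k =>
    ((hv k).continuous.mul (pd_smooth hw k).continuous).integrable_of_hasCompactSupport
      ((hc k).mul_right)
  have i2 : ∀ k, Integrable (fun x => pd k (fun y => v y k) x * w x) := fun k =>
    ((pd_smooth (hv k) k).continuous.mul hw.continuous).integrable_of_hasCompactSupport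
      ((hc' k).mul_right)
  have i3 : ∀ k, Integrable (fun x => v x k * w x) := fun k =>
    ((hv k).continuous.mul hw.continuous).integrable_of_hasCompactSupport
      ((hc k).mul_right)
  have ibp : ∀ k, ∫ x, v x k * pd k w x = - ∫ x, pd k (fun y => v y k) x * w x := fun k =>
    integral_mul_fderiv_eq_neg_fderiv_mul_of_integrable (i2 k) (i1 k) (i3 k)
      (fun x _ => sm_diff (hv k) x) (fun x _ => sm_diff hw x)
  rw [integral_finsetSum _ (fun k _ => i1 k)]
  simp only [ibp]
  rw [Finset.sum_neg_distrib, ← integral_finsetSum _ (fun k _ => i2 k)]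
  simp [← Finset.sum_mul, hdiv]

/-- Principle of virtual work: under transport variations `δφ = −v·∇φ`, `δψ = −v·∇ψ`
with a divergence-free virtual displacement `v` compactly supported in `Ω`,
`d/ds E[φ − s v·∇φ, ψ − s v·∇ψ]|₀ = ∫_Ω σ̃ᵉ : ∇v dx`, where
`σ̃ᵉ = −γ₁ε₁((ψ−1)/2)² ∇φ⊗∇φ − γ₂ε₂ ∇ψ⊗∇ψ`. -/
theorem stmt4 (γ1 γ2 ε1 ε2 : ℝ) (hγ1 : 0 < γ1) (hγ2 : 0 < γ2) (hε1 : 0 < ε1) (hε2 : 0 < ε2)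
    (Ω : Set (Fin 2 → ℝ)) (hΩo : IsOpen Ω) (hΩb : Bornology.IsBounded Ω)
    (φ ψ : (Fin 2 → ℝ) → ℝ) (v : (Fin 2 → ℝ) → (Fin 2 → ℝ))
    (hφ : ContDiff ℝ (⊤ : ℕ∞) φ) (hψ : ContDiff ℝ (⊤ : ℕ∞) ψ) (hv : ContDiff ℝ (⊤ : ℕ∞) v)
    (hvc : HasCompactSupport v) (hvs : tsupport v ⊆ Ω)
    (hdiv : ∀ x, ∑ j, pd j (fun y => v y j) x = 0) :
    HasDerivAt
      (fun s : ℝ => ∫ x in Ω,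
        W γ1 γ2 ε1 ε2
          (fun y => φ y - s * ∑ j, v y j * pd j φ y)
          (fun y => ψ y - s * ∑ j, v y j * pd j ψ y) x)
      (-∫ x in Ω, ∑ i, ∑ j,
        (γ1 * ε1 * ((ψ x - 1) / 2) ^ 2 * pd i φ x * pd j φ x
          + γ2 * ε2 * pd i ψ x * pd j ψ x) * pd i (fun y => v y j) x)
      0 := by
  have hvj : ∀ j, ContDiff ℝ (⊤ : ℕ∞) (fun y => v y j) := fun j => contDiff_pi.1 hv j
  have ha : ContDiff ℝ (⊤ : ℕ∞) (fun y => ∑ j, v y j * pd j φ y) :=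
    ContDiff.sum fun j _ => (hvj j).mul (pd_smooth hφ j)
  have hb : ContDiff ℝ (⊤ : ℕ∞) (fun y => ∑ j, v y j * pd j ψ y) :=
    ContDiff.sum fun j _ => (hvj j).mul (pd_smooth hψ j)
  have ta := fun i x => pd_transport hφ hvj i x
  have tb := fun i x => pd_transport hψ hvj i x
  have ea : ∀ x, (∑ j, v x j * pd j φ x) = v x 0 * pd 0 φ x + v x 1 * pd 1 φ x := by
    simp [Fin.sum_univ_two]
  have eb : ∀ x, (∑ j, v x j * pd j ψ x) = v x 0 * pd 0 ψ x + v x 1 * pd 1 ψ x := by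
    simp [Fin.sum_univ_two]
  have ea' := fun x => (ea x)
  generalize hA : (fun y => ∑ j, v y j * pd j φ y) = a at ha ta
  generalize hB : (fun y => ∑ j, v y j * pd j ψ y) = b at hb tb
  have hA' : ∀ y, (∑ j, v y j * pd j φ y) = a y := fun y => congrFun hA y
  have hB' : ∀ y, (∑ j, v y j * pd j ψ y) = b y := fun y => congrFun hB y
  simp only [hA'] at ea
  simp only [hB'] at eb
  simp only [hA', hB']
  have hWs : ∀ (s : ℝ) x, W γ1 γ2 ε1 ε2 (fun y => φ y - s * a y) (fun y => ψ y - s * b y) x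
      = wf γ1 γ2 ε1 ε2 (φ x - s * a x) (ψ x - s * b x)
        (pd 0 φ x - s * pd 0 a x) (pd 1 φ x - s * pd 1 a x)
        (pd 0 ψ x - s * pd 0 b x) (pd 1 ψ x - s * pd 1 b x) := by
    intro s x
    rw [W_eq, pd_sub_mul hφ ha, pd_sub_mul hφ ha, pd_sub_mul hψ hb, pd_sub_mul hψ hb]
  let F' : ℝ → (Fin 2 → ℝ) → ℝ := fun s x =>
    wd γ1 γ2 ε1 ε2 (φ x - s * a x) (ψ x - s * b x)
        (pd 0 φ x - s * pd 0 a x) (pd 1 φ x - s * pd 1 a x)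
        (pd 0 ψ x - s * pd 0 b x) (pd 1 ψ x - s * pd 1 b x)
        (-a x) (-b x) (-pd 0 a x) (-pd 1 a x) (-pd 0 b x) (-pd 1 b x)
  have c1 := hφ.continuous
  have c2 := hψ.continuous
  have c3 := ha.continuous
  have c4 := hb.continuous
  have c5 := fun i => (pd_smooth hφ i).continuous
  have c6 := fun i => (pd_smooth hψ i).continuous
  have c7 := fun i => (pd_smooth ha i).continuous
  have c8 := fun i => (pd_smooth hb i).continuous
  have hF'c : Continuous (fun p : ℝ × (Fin 2 → ℝ) => F' p.1 p.2) := by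
    have := c5 0
    have := c5 1
    have := c6 0
    have := c6 1
    have := c7 0
    have := c7 1
    have := c8 0
    have := c8 1
    simp only [F', wd]
    fun_prop
  have hK : IsCompact (closure Ω) := hΩb.isCompact_closure
  obtain ⟨C, hC⟩ := ((isCompact_Icc (a := (-1 : ℝ)) (b := 1)).prod hK).exists_bound_of_continuousOn
    hF'c.continuousOn
  have hfin : volume Ω < ⊤ := hΩb.measure_lt_top
  have hio : ∀ f : (Fin 2 → ℝ) → ℝ, Continuous f → IntegrableOn f Ω := fun f hf =>
    (hf.continuousOn.integrableOn_compact hK).mono_set subset_closure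
  have hWc : ∀ s : ℝ, Continuous
      (fun x => W γ1 γ2 ε1 ε2 (fun y => φ y - s * a y) (fun y => ψ y - s * b y) x) := fun s =>
    (W_smooth γ1 γ2 ε1 ε2 (hφ.sub (contDiff_const.mul ha))
      (hψ.sub (contDiff_const.mul hb))).continuous
  have main := (hasDerivAt_integral_of_dominated_loc_of_deriv_le (μ := volume.restrict Ω)
    (s := Set.Icc (-1 : ℝ) 1) (x₀ := 0)
    (F := fun s x => W γ1 γ2 ε1 ε2 (fun y => φ y - s * a y) (fun y => ψ y - s * b y) x)
    (F' := F') (bound := fun _ => C)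
    (Icc_mem_nhds (by norm_num) (by norm_num))
    (Filter.Eventually.of_forall fun s => (hWc s).aestronglyMeasurable)
    (hio _ (hWc 0))
    ((hF'c.comp (Continuous.prodMk_right 0)).aestronglyMeasurable)
    ((ae_restrict_iff' hΩo.measurableSet).2 (Filter.Eventually.of_forall fun x hx s hs =>
      hC (s, x) ⟨hs, subset_closure hx⟩))
    (integrableOn_const hfin.ne)
    (Filter.Eventually.of_forall fun x s _ => by
      simp only [hWs]
      have hl : ∀ p q : ℝ, HasDerivAt (fun s : ℝ => p - s * q) (-q) s := fun p q => by
        simpa using ((hasDerivAt_id s).mul_const q).const_sub p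
      exact wf_hasDerivAt γ1 γ2 ε1 ε2 (hl _ _) (hl _ _) (hl _ _) (hl _ _) (hl _ _) (hl _ _))).2
  refine main.congr_deriv ?_
  have hwS := W_smooth γ1 γ2 ε1 ε2 hφ hψ
  have hpt : ∀ x, F' 0 x = -(∑ k, v x k * pd k (W γ1 γ2 ε1 ε2 φ ψ) x) -
      ∑ i, ∑ j,
        (γ1 * ε1 * ((ψ x - 1) / 2) ^ 2 * pd i φ x * pd j φ x
          + γ2 * ε2 * pd i ψ x * pd j ψ x) * pd i (fun y => v y j) x := by
    intro x
    simp only [F', Fin.sum_univ_two, pd_W γ1 γ2 ε1 ε2 hφ hψ, ta, tb, ea, eb, zero_mul, sub_zero]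
    unfold wd
    ring
  have hz : ∫ x in Ω, ∑ k, v x k * pd k (W γ1 γ2 ε1 ε2 φ ψ) x = 0 := by
    rw [setIntegral_eq_integral_of_forall_compl_eq_zero, transport_zero hwS hvj hvc hdiv]
    intro x hx
    have : v x = 0 := image_eq_zero_of_notMem_tsupport fun h => hx (hvs h)
    simp [this]
  simp only [hpt]
  rw [integral_sub, integral_neg, hz]
  · simp
  · refine (hio _ ?_).neg
    exact continuous_finsetSum _ fun k _ => (hvj k).continuous.mul (pd_smooth hwS k).continuous
  · refine hio _ ?_
    refine continuous_finsetSum _ fun i _ => continuous_finsetSum _ fun j _ => ?_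
    have := c5 i
    have := c5 j
    have := c6 i
    have := c6 j
    have := (pd_smooth (hvj j) i).continuous
    fun_prop
end

section
/- Let T > 0, let Q = [0,1)² denote the periodic unit cell, and let u : ℝ² × [0,T] → ℝ², p, φ, ψ : ℝ² × [0,T] → ℝ be smooth functions, ℤ²-periodic in the space variable, satisfying the multi-phase hydrodynamic system: ρ(u_t + u·∇u) + ∇p = λ ∇·σ̃ᵉ + μΔu, ∇·u = 0, φ_t + u·∇φ = −M₁ δE/δφ, and ψ_t + u·∇ψ = −M₂ δE/δψ, where σ̃ᵉ = −γ₁ε₁((ψ−1)/2)²∇φ⊗∇φ − γ₂ε₂∇ψ⊗∇ψ, and ρ, μ, λ, M₁, M₂ are positive constants. Then the total energy 𝓔(t) = ∫_Q ( (ρ/2)|u|² + λ W(φ,∇φ,ψ,∇ψ) ) dx satisfies the energy dissipation law d𝓔/dt = −∫_Q ( μ|∇u|² + λM₁|δE/δφ|² + λM₂|δE/δψ|² ) dx for all t ∈ (0,T). -/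
open MeasureTheory

/-- The periodic unit cell `Q = [0,1)²`. -/
def Q : Set (Fin 2 → ℝ) := Set.univ.pi fun _ => Set.Ico (0 : ℝ) 1

/-- Variational derivative `δE/δφ = −γ₁(ε₁ ∇·[((ψ−1)/2)²∇φ] − (1/ε₁)((ψ−1)/2)²(φ²−1)φ)`. -/
noncomputable def dEdφ (γ1 ε1 : ℝ) (φ ψ : (Fin 2 → ℝ) → ℝ) (x : Fin 2 → ℝ) : ℝ :=
  -γ1 * (ε1 * (∑ j, pd j (fun y => ((ψ y - 1) / 2) ^ 2 * pd j φ y) x)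
    - (1 / ε1) * ((ψ x - 1) / 2) ^ 2 * ((φ x) ^ 2 - 1) * φ x)

/-- Variational derivative
`δE/δψ = −γ₂(ε₂Δψ − (1/ε₂)(ψ²−1)ψ) + γ₁((ψ−1)/2)((ε₁/2)|∇φ|² + (1/(4ε₁))(φ²−1)²)`. -/
noncomputable def dEdψ (γ1 γ2 ε1 ε2 : ℝ) (φ ψ : (Fin 2 → ℝ) → ℝ) (x : Fin 2 → ℝ) : ℝ :=
  -γ2 * (ε2 * (∑ j, pd j (fun y => pd j ψ y) x) - (1 / ε2) * ((ψ x) ^ 2 - 1) * ψ x)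
  + γ1 * ((ψ x - 1) / 2) *
      ((ε1 / 2) * ∑ j, (pd j φ x) ^ 2 + (1 / (4 * ε1)) * ((φ x) ^ 2 - 1) ^ 2)

/-- The simplified elastic stress `σ̃ᵉ = −γ₁ε₁((ψ−1)/2)²∇φ⊗∇φ − γ₂ε₂∇ψ⊗∇ψ`. -/
noncomputable def sigmaE (γ1 γ2 ε1 ε2 : ℝ) (φ ψ : (Fin 2 → ℝ) → ℝ) (x : Fin 2 → ℝ)
    (i j : Fin 2) : ℝ :=
  -(γ1 * ε1 * ((ψ x - 1) / 2) ^ 2 * pd i φ x * pd j φ x)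
  - γ2 * ε2 * pd i ψ x * pd j ψ x


/-- Space-time. -/
abbrev SpT := ℝ × (Fin 2 → ℝ)

/-- Smooth scalar functions on space-time. -/
def Sm (f : SpT → ℝ) : Prop := ContDiff ℝ (⊤ : ℕ∞) f

/-- Directional derivative on space-time. -/
noncomputable def DD (v : SpT) (f : SpT → ℝ) (q : SpT) : ℝ := fderiv ℝ f q v

/-- Time direction. -/
noncomputable def et : SpT := (1, 0)

/-- Space directions. -/
noncomputable def ex (j : Fin 2) : SpT := (0, Pi.single j 1)

/-- Spatial periodicity. -/
def Per (f : SpT → ℝ) : Prop :=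
  ∀ (m : Fin 2 → ℤ) (q : SpT), f (q + ((0 : ℝ), fun i => (m i : ℝ))) = f q

theorem Sm.da {f : SpT → ℝ} (hf : Sm f) (q : SpT) : DifferentiableAt ℝ f q :=
  (ContDiff.differentiable hf (by simp)) q

theorem Sm.cont {f : SpT → ℝ} (hf : Sm f) : Continuous f := ContDiff.continuous hf

theorem Sm.dd {f : SpT → ℝ} (hf : Sm f) (v : SpT) : Sm (DD v f) := by
  have h : ContDiff ℝ (⊤ : ℕ∞) (fderiv ℝ f) :=
    ContDiff.fderiv_right (m := ((⊤ : ℕ∞) : WithTop ℕ∞)) hf (by simp)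
  exact h.clm_apply contDiff_const

theorem Sm.const (c : ℝ) : Sm (fun _ => c) := contDiff_const
theorem Sm.add {f g : SpT → ℝ} (hf : Sm f) (hg : Sm g) : Sm (fun q => f q + g q) :=
  ContDiff.add hf hg
theorem Sm.sub {f g : SpT → ℝ} (hf : Sm f) (hg : Sm g) : Sm (fun q => f q - g q) :=
  ContDiff.sub hf hg
theorem Sm.mul {f g : SpT → ℝ} (hf : Sm f) (hg : Sm g) : Sm (fun q => f q * g q) :=
  ContDiff.mul hf hg
theorem Sm.neg {f : SpT → ℝ} (hf : Sm f) : Sm (fun q => - f q) := ContDiff.neg hf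
theorem Sm.sq {f : SpT → ℝ} (hf : Sm f) : Sm (fun q => f q ^ 2) := ContDiff.pow hf 2
theorem Sm.div2 {f : SpT → ℝ} (hf : Sm f) : Sm (fun q => f q / 2) := ContDiff.div_const hf 2

theorem DD_const (v : SpT) (c : ℝ) (q : SpT) : DD v (fun _ => c) q = 0 := by
  simp [DD]
theorem DD_add (v : SpT) {f g : SpT → ℝ} (q : SpT) (hf : Sm f) (hg : Sm g) :
    DD v (fun q => f q + g q) q = DD v f q + DD v g q := by
  simp [DD, fderiv_fun_add (hf.da q) (hg.da q)]
theorem DD_sub (v : SpT) {f g : SpT → ℝ} (q : SpT) (hf : Sm f) (hg : Sm g) :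
    DD v (fun q => f q - g q) q = DD v f q - DD v g q := by
  simp [DD, fderiv_fun_sub (hf.da q) (hg.da q)]
theorem DD_neg (v : SpT) {f : SpT → ℝ} (q : SpT) :
    DD v (fun q => - f q) q = - DD v f q := by
  simp [DD, fderiv_fun_neg]
theorem DD_mul (v : SpT) {f g : SpT → ℝ} (q : SpT) (hf : Sm f) (hg : Sm g) :
    DD v (fun q => f q * g q) q = f q * DD v g q + g q * DD v f q := by
  simp [DD, fderiv_fun_mul (hf.da q) (hg.da q)]
theorem DD_sq (v : SpT) {f : SpT → ℝ} (q : SpT) (hf : Sm f) :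
    DD v (fun q => f q ^ 2) q = 2 * f q * DD v f q := by
  simp only [pow_two, DD_mul v q hf hf]; ring
theorem DD_div2 (v : SpT) {f : SpT → ℝ} (q : SpT) (hf : Sm f) :
    DD v (fun q => f q / 2) q = DD v f q / 2 := by
  simp only [div_eq_mul_inv]
  rw [DD_mul v q hf (Sm.const _), DD_const]; ring

theorem DD_comm (v w : SpT) {f : SpT → ℝ} (hf : Sm f) (q : SpT) :
    DD v (DD w f) q = DD w (DD v f) q := by
  have h : ContDiff ℝ (⊤ : ℕ∞) (fderiv ℝ f) :=
    ContDiff.fderiv_right (m := ((⊤ : ℕ∞) : WithTop ℕ∞)) hf (by simp)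
  have hd : DifferentiableAt ℝ (fderiv ℝ f) q := (h.differentiable (by simp)) q
  have key : ∀ a b : SpT, DD a (DD b f) q = fderiv ℝ (fderiv ℝ f) q a b := by
    intro a b
    have : DD b f = fun y => fderiv ℝ f y b := rfl
    rw [this]
    simp only [DD]
    rw [fderiv_clm_apply hd (differentiableAt_const b)]
    simp
  rw [key, key]
  have hs : IsSymmSndFDerivAt ℝ f q :=
    (ContDiff.contDiffAt hf).isSymmSndFDerivAt (by simp; exact WithTop.coe_le_coe.2 le_top)
  exact hs v w

theorem pd_eq {f : SpT → ℝ} (hf : Sm f) (j : Fin 2) (t : ℝ) (x : Fin 2 → ℝ) :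
    pd j (fun y => f (t, y)) x = DD (ex j) f (t, x) := by
  have h2 : HasFDerivAt (fun y : Fin 2 → ℝ => ((t, y) : SpT))
      (ContinuousLinearMap.inr ℝ ℝ (Fin 2 → ℝ)) x := hasFDerivAt_prodMk_right t x
  have h3 := (hf.da (t, x)).hasFDerivAt.comp x h2
  have h4 : fderiv ℝ (fun y => f (t, y)) x = _ := h3.fderiv
  simp [pd, DD, ex, h4]

theorem hasDerivAt_time {f : SpT → ℝ} (hf : Sm f) (t : ℝ) (x : Fin 2 → ℝ) :
    HasDerivAt (fun s => f (s, x)) (DD et f (t, x)) t := by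
  have h2 : HasFDerivAt (fun y : ℝ => ((y, x) : SpT))
      (ContinuousLinearMap.inl ℝ ℝ (Fin 2 → ℝ)) t := hasFDerivAt_prodMk_left t x
  have h3 := ((hf.da (t, x)).hasFDerivAt.comp t h2).hasDerivAt
  have h5 : DD et f (t, x) = ((fderiv ℝ f (t, x)).comp (ContinuousLinearMap.inl ℝ ℝ (Fin 2 → ℝ))) 1 := by
    simp [DD, et]
  rw [h5]
  exact h3

theorem deriv_time_eq {f : SpT → ℝ} (hf : Sm f) (t : ℝ) (x : Fin 2 → ℝ) :
    deriv (fun s => f (s, x)) t = DD et f (t, x) := (hasDerivAt_time hf t x).deriv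

theorem Per.dd {f : SpT → ℝ} (hf : Per f) (v : SpT) : Per (DD v f) := by
  intro m q
  have : f = fun y => f (y + ((0 : ℝ), fun i => (m i : ℝ))) := by
    funext y; exact (hf m y).symm
  unfold DD
  conv_rhs => rw [this]
  rw [fderiv_comp_add_right]
theorem Per.const (c : ℝ) : Per (fun _ => c) := fun _ _ => rfl
theorem Per.add {f g : SpT → ℝ} (hf : Per f) (hg : Per g) : Per (fun q => f q + g q) :=
  fun m q => by simp only [hf m q, hg m q]
theorem Per.sub {f g : SpT → ℝ} (hf : Per f) (hg : Per g) : Per (fun q => f q - g q) :=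
  fun m q => by simp only [hf m q, hg m q]
theorem Per.mul {f g : SpT → ℝ} (hf : Per f) (hg : Per g) : Per (fun q => f q * g q) :=
  fun m q => by simp only [hf m q, hg m q]
theorem Per.neg {f : SpT → ℝ} (hf : Per f) : Per (fun q => - f q) :=
  fun m q => by simp only [hf m q]
theorem Per.sq {f : SpT → ℝ} (hf : Per f) : Per (fun q => f q ^ 2) :=
  fun m q => by simp only [hf m q]
theorem Per.div2 {f : SpT → ℝ} (hf : Per f) : Per (fun q => f q / 2) :=
  fun m q => by simp only [hf m q]

theorem Q_ae : (Q : Set (Fin 2 → ℝ)) =ᵐ[volume] Set.Icc (0 : Fin 2 → ℝ) 1 := by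
  have := Measure.univ_pi_Ico_ae_eq_Icc (μ := fun _ : Fin 2 => (volume : Measure ℝ))
    (f := fun _ => (0 : ℝ)) (g := fun _ => 1)
  exact this

theorem intOn {f : SpT → ℝ} (hf : Continuous f) (t : ℝ) :
    IntegrableOn (fun x => f (t, x)) Q volume := by
  rw [integrableOn_congr_set_ae Q_ae]
  exact (Continuous.continuousOn (by fun_prop)).integrableOn_compact isCompact_Icc

theorem int_dd_zero {F : Fin 2 → SpT → ℝ} (hF : ∀ j, Sm (F j)) (hP : ∀ j, Per (F j)) (t : ℝ) :
    ∫ x in Q, (DD (ex 0) (F 0) (t, x) + DD (ex 1) (F 1) (t, x)) = 0 := by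
  rw [setIntegral_congr_set Q_ae]
  have hsm : ∀ j, ContDiff ℝ (⊤ : ℕ∞) (fun x : Fin 2 → ℝ => F j (t, x)) := fun j =>
    ContDiff.comp (hF j) (contDiff_const.prodMk contDiff_id)
  have h := integral_divergence_of_hasFDerivAt_off_countable' (n := 1) (E := ℝ)
    (a := (0 : Fin 2 → ℝ)) (b := 1) (by intro i; simp)
    (fun j x => F j (t, x)) (fun j x => fderiv ℝ (fun y => F j (t, y)) x) ∅ (by simp)
    (fun j => (hsm j).continuous.continuousOn)
    (fun x _ j => ((hsm j).differentiable (by simp) x).hasFDerivAt)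
    (by
      refine (Continuous.continuousOn ?_).integrableOn_compact isCompact_Icc
      refine continuous_finsetSum _ fun j _ => ?_
      exact ((hsm j).continuous_fderiv (by simp)).clm_apply continuous_const)
  have e : ∀ x : Fin 2 → ℝ, DD (ex 0) (F 0) (t, x) + DD (ex 1) (F 1) (t, x)
      = ∑ i : Fin 2, (fderiv ℝ (fun y => F i (t, y)) x) (Pi.single i 1) := by
    intro x
    rw [Fin.sum_univ_two, ← pd_eq (hF 0), ← pd_eq (hF 1)]; rfl
  simp only [e]
  refine h.trans ?_
  refine Finset.sum_eq_zero fun i _ => ?_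
  rw [sub_eq_zero]
  refine integral_congr_ae (Filter.Eventually.of_forall fun x => ?_)
  have hp := hP i (Pi.single i 1) (t, i.insertNth (0 : ℝ) x)
  simp only [Pi.zero_apply, Pi.one_apply]
  rw [← hp]
  congr 1
  ext k
  · simp
  · refine Fin.succAboveCases i ?_ (fun k => ?_) k
    · simp
    · simp

theorem hasDeriv_int {f : SpT → ℝ} (hf : Sm f) (t : ℝ) :
    HasDerivAt (fun s => ∫ x in Q, f (s, x)) (∫ x in Q, DD et f (t, x)) t := by
  have hK : IsCompact (Metric.closedBall t 1 ×ˢ Set.Icc (0 : Fin 2 → ℝ) 1) :=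
    (isCompact_closedBall t 1).prod isCompact_Icc
  obtain ⟨C, hC⟩ := hK.exists_bound_of_continuousOn (hf.dd et).cont.continuousOn
  have hfin : IsFiniteMeasure (volume.restrict Q : Measure (Fin 2 → ℝ)) := by
    rw [Measure.restrict_congr_set Q_ae]
    exact ⟨by simpa using (isCompact_Icc (a := (0 : Fin 2 → ℝ)) (b := 1)).measure_lt_top⟩
  have hQm : MeasurableSet Q := MeasurableSet.univ_pi fun _ => measurableSet_Ico
  refine (hasDerivAt_integral_of_dominated_loc_of_deriv_le (bound := fun _ => C)
    (μ := volume.restrict Q) (F := fun s x => f (s, x)) (F' := fun s x => DD et f (s, x))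
    (Metric.ball_mem_nhds t one_pos) ?_ (intOn hf.cont t) ?_ ?_ (integrable_const C) ?_).2
  · refine Filter.Eventually.of_forall fun s => ?_
    exact (intOn hf.cont s).aestronglyMeasurable
  · exact (intOn (hf.dd et).cont t).aestronglyMeasurable
  · rw [ae_restrict_iff' hQm]
    refine Filter.Eventually.of_forall fun x hx s hs => ?_
    refine hC (s, x) ⟨Metric.ball_subset_closedBall hs, ?_⟩
    exact ⟨fun i => (hx i trivial).1, fun i => (hx i trivial).2.le⟩
  · exact Filter.Eventually.of_forall fun x s _ => hasDerivAt_time hf s x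

/-- Energy density on space-time. -/
noncomputable def Wf (γ1 γ2 ε1 ε2 : ℝ) (Φ Ψ : SpT → ℝ) (q : SpT) : ℝ :=
  γ1 * ((Ψ q - 1) / 2) ^ 2 *
      ((ε1 / 2) * (DD (ex 0) Φ q ^ 2 + DD (ex 1) Φ q ^ 2) + (1 / (4 * ε1)) * (Φ q ^ 2 - 1) ^ 2)
  + γ2 * ((ε2 / 2) * (DD (ex 0) Ψ q ^ 2 + DD (ex 1) Ψ q ^ 2)
      + (1 / (4 * ε2)) * (Ψ q ^ 2 - 1) ^ 2)

/-- `((ψ-1)/2)² ∂ⱼφ`. -/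
noncomputable def Gf (Φ Ψ : SpT → ℝ) (j : Fin 2) (q : SpT) : ℝ :=
  ((Ψ q - 1) / 2) ^ 2 * DD (ex j) Φ q

/-- Variational derivative in `φ` on space-time. -/
noncomputable def Af (γ1 ε1 : ℝ) (Φ Ψ : SpT → ℝ) (q : SpT) : ℝ :=
  -γ1 * (ε1 * (DD (ex 0) (Gf Φ Ψ 0) q + DD (ex 1) (Gf Φ Ψ 1) q)
    - (1 / ε1) * ((Ψ q - 1) / 2) ^ 2 * (Φ q ^ 2 - 1) * Φ q)

/-- Variational derivative in `ψ` on space-time. -/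
noncomputable def Bf (γ1 γ2 ε1 ε2 : ℝ) (Φ Ψ : SpT → ℝ) (q : SpT) : ℝ :=
  -γ2 * (ε2 * (DD (ex 0) (DD (ex 0) Ψ) q + DD (ex 1) (DD (ex 1) Ψ) q)
      - (1 / ε2) * (Ψ q ^ 2 - 1) * Ψ q)
  + γ1 * ((Ψ q - 1) / 2) *
      ((ε1 / 2) * (DD (ex 0) Φ q ^ 2 + DD (ex 1) Φ q ^ 2) + (1 / (4 * ε1)) * (Φ q ^ 2 - 1) ^ 2)

/-- Stress on space-time. -/
noncomputable def Sf (γ1 γ2 ε1 ε2 : ℝ) (Φ Ψ : SpT → ℝ) (i j : Fin 2) (q : SpT) : ℝ :=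
  -(γ1 * ε1 * ((Ψ q - 1) / 2) ^ 2 * DD (ex i) Φ q * DD (ex j) Φ q)
  - γ2 * ε2 * DD (ex i) Ψ q * DD (ex j) Ψ q

/-- Energy flux from the time derivative of `W`. -/
noncomputable def Hf (γ1 γ2 ε1 ε2 : ℝ) (Φ Ψ : SpT → ℝ) (j : Fin 2) (q : SpT) : ℝ :=
  γ1 * ε1 * (Gf Φ Ψ j q * DD et Φ q) + γ2 * ε2 * (DD (ex j) Ψ q * DD et Ψ q)

/-- Total energy flux. -/
noncomputable def Ff (ρ μ lam γ1 γ2 ε1 ε2 : ℝ) (U : Fin 2 → SpT → ℝ) (P Φ Ψ : SpT → ℝ)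
    (j : Fin 2) (q : SpT) : ℝ :=
  μ * (U 0 q * DD (ex j) (U 0) q + U 1 q * DD (ex j) (U 1) q)
    + lam * Hf γ1 γ2 ε1 ε2 Φ Ψ j q
    - ((ρ / 2) * (U 0 q ^ 2 + U 1 q ^ 2) + P q + lam * Wf γ1 γ2 ε1 ε2 Φ Ψ q) * U j q

/-- Total energy density. -/
noncomputable def Ef (ρ lam γ1 γ2 ε1 ε2 : ℝ) (U : Fin 2 → SpT → ℝ) (Φ Ψ : SpT → ℝ)
    (q : SpT) : ℝ :=
  (ρ / 2) * (U 0 q ^ 2 + U 1 q ^ 2) + lam * Wf γ1 γ2 ε1 ε2 Φ Ψ q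

section
variable (γ1 γ2 ε1 ε2 : ℝ) {Φ Ψ : SpT → ℝ} (hΦ : Sm Φ) (hΨ : Sm Ψ)

theorem Gf_sm (hΦ : Sm Φ) (hΨ : Sm Ψ) (j : Fin 2) : Sm (Gf Φ Ψ j) :=
  ((hΨ.sub (.const 1)).div2.sq).mul (hΦ.dd _)

theorem DD_Gf (hΦ : Sm Φ) (hΨ : Sm Ψ) (j : Fin 2) (v q : SpT) :
    DD v (Gf Φ Ψ j) q = ((Ψ q - 1) / 2) ^ 2 * DD v (DD (ex j) Φ) q
      + DD (ex j) Φ q * (((Ψ q - 1) / 2) * DD v Ψ q) := by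
  have : Gf Φ Ψ j = fun q => ((Ψ q - 1) / 2) ^ 2 * DD (ex j) Φ q := rfl
  rw [this, DD_mul v q (hΨ.sub (.const 1)).div2.sq (hΦ.dd _),
    DD_sq v q (hΨ.sub (.const 1)).div2, DD_div2 v q (hΨ.sub (.const 1)),
    DD_sub v q hΨ (.const 1), DD_const]
  ring

theorem Wf_sm (hΦ : Sm Φ) (hΨ : Sm Ψ) : Sm (Wf γ1 γ2 ε1 ε2 Φ Ψ) :=
  (((Sm.const γ1).mul (hΨ.sub (.const 1)).div2.sq).mul
    (((Sm.const _).mul ((hΦ.dd _).sq.add (hΦ.dd _).sq)).add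
      ((Sm.const _).mul (hΦ.sq.sub (.const 1)).sq))).add
  ((Sm.const γ2).mul (((Sm.const _).mul ((hΨ.dd _).sq.add (hΨ.dd _).sq)).add
      ((Sm.const _).mul (hΨ.sq.sub (.const 1)).sq)))

theorem DD_Wf (hΦ : Sm Φ) (hΨ : Sm Ψ) (v q : SpT) :
    DD v (Wf γ1 γ2 ε1 ε2 Φ Ψ) q =
      γ1 * ((Ψ q - 1) / 2) ^ 2 * (ε1 * (DD (ex 0) Φ q * DD v (DD (ex 0) Φ) q
          + DD (ex 1) Φ q * DD v (DD (ex 1) Φ) q) + (1 / ε1) * (Φ q ^ 2 - 1) * Φ q * DD v Φ q)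
      + γ1 * ((Ψ q - 1) / 2) * DD v Ψ q * ((ε1 / 2) * (DD (ex 0) Φ q ^ 2 + DD (ex 1) Φ q ^ 2)
          + (1 / (4 * ε1)) * (Φ q ^ 2 - 1) ^ 2)
      + γ2 * (ε2 * (DD (ex 0) Ψ q * DD v (DD (ex 0) Ψ) q
          + DD (ex 1) Ψ q * DD v (DD (ex 1) Ψ) q)
          + (1 / ε2) * (Ψ q ^ 2 - 1) * Ψ q * DD v Ψ q) := by
  unfold Wf
  simp (maxDischargeDepth := 20) only [DD_add, DD_sub, DD_mul, DD_sq, DD_div2, DD_const,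
    Sm.add, Sm.sub, Sm.mul, Sm.sq, Sm.div2, Sm.const, Sm.dd, hΦ, hΨ]
  ring

theorem Sf_sm (hΦ : Sm Φ) (hΨ : Sm Ψ) (i j : Fin 2) : Sm (Sf γ1 γ2 ε1 ε2 Φ Ψ i j) :=
  (((((Sm.const _).mul (hΨ.sub (.const 1)).div2.sq).mul (hΦ.dd _)).mul (hΦ.dd _)).neg).sub
    (((Sm.const _).mul (hΨ.dd _)).mul (hΨ.dd _))

theorem div_Sf (hΦ : Sm Φ) (hΨ : Sm Ψ) (i : Fin 2) (q : SpT) :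
    DD (ex 0) (Sf γ1 γ2 ε1 ε2 Φ Ψ i 0) q + DD (ex 1) (Sf γ1 γ2 ε1 ε2 Φ Ψ i 1) q
      = Af γ1 ε1 Φ Ψ q * DD (ex i) Φ q + Bf γ1 γ2 ε1 ε2 Φ Ψ q * DD (ex i) Ψ q
        - DD (ex i) (Wf γ1 γ2 ε1 ε2 Φ Ψ) q := by
  rw [DD_Wf _ _ _ _ hΦ hΨ]
  unfold Sf Af Bf
  simp (maxDischargeDepth := 20) only [DD_add, DD_sub, DD_neg, DD_mul, DD_sq, DD_div2, DD_const,
    Sm.add, Sm.sub, Sm.mul, Sm.neg, Sm.sq, Sm.div2, Sm.const, Sm.dd, hΦ, hΨ, DD_Gf,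
    DD_comm (ex i) _ hΦ, DD_comm (ex i) _ hΨ]
  ring

theorem Hf_sm (hΦ : Sm Φ) (hΨ : Sm Ψ) (j : Fin 2) : Sm (Hf γ1 γ2 ε1 ε2 Φ Ψ j) :=
  ((Sm.const _).mul ((Gf_sm hΦ hΨ j).mul (hΦ.dd _))).add
    ((Sm.const _).mul ((hΨ.dd _).mul (hΨ.dd _)))

theorem DD_Hf (hΦ : Sm Φ) (hΨ : Sm Ψ) (j : Fin 2) (v q : SpT) :
    DD v (Hf γ1 γ2 ε1 ε2 Φ Ψ j) q =
      γ1 * ε1 * (Gf Φ Ψ j q * DD v (DD et Φ) q + DD et Φ q * DD v (Gf Φ Ψ j) q)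
      + γ2 * ε2 * (DD (ex j) Ψ q * DD v (DD et Ψ) q + DD et Ψ q * DD v (DD (ex j) Ψ) q) := by
  have : Hf γ1 γ2 ε1 ε2 Φ Ψ j = fun q =>
    γ1 * ε1 * (Gf Φ Ψ j q * DD et Φ q) + γ2 * ε2 * (DD (ex j) Ψ q * DD et Ψ q) := rfl
  rw [this]
  simp (maxDischargeDepth := 20) only [DD_add, DD_mul, DD_const,
    Sm.add, Sm.mul, Sm.const, Sm.dd, hΦ, hΨ, Gf_sm]
  ring

theorem Wf_time (hΦ : Sm Φ) (hΨ : Sm Ψ) (q : SpT) :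
    DD et (Wf γ1 γ2 ε1 ε2 Φ Ψ) q
      = Af γ1 ε1 Φ Ψ q * DD et Φ q + Bf γ1 γ2 ε1 ε2 Φ Ψ q * DD et Ψ q
        + (DD (ex 0) (Hf γ1 γ2 ε1 ε2 Φ Ψ 0) q + DD (ex 1) (Hf γ1 γ2 ε1 ε2 Φ Ψ 1) q) := by
  rw [DD_Wf _ _ _ _ hΦ hΨ, DD_Hf _ _ _ _ hΦ hΨ, DD_Hf _ _ _ _ hΦ hΨ]
  simp only [Af, Bf, DD_comm et _ hΦ, DD_comm et _ hΨ, DD_Gf hΦ hΨ, Gf]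
  ring

theorem Ef_sm (ρ lam : ℝ) {U : Fin 2 → SpT → ℝ} (hU : ∀ i, Sm (U i)) (hΦ : Sm Φ) (hΨ : Sm Ψ) :
    Sm (Ef ρ lam γ1 γ2 ε1 ε2 U Φ Ψ) :=
  ((Sm.const _).mul ((hU 0).sq.add (hU 1).sq)).add ((Sm.const _).mul (Wf_sm _ _ _ _ hΦ hΨ))

theorem Ff_sm (ρ μ lam : ℝ) {U : Fin 2 → SpT → ℝ} {P : SpT → ℝ} (hU : ∀ i, Sm (U i))
    (hP : Sm P) (hΦ : Sm Φ) (hΨ : Sm Ψ) (j : Fin 2) :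
    Sm (Ff ρ μ lam γ1 γ2 ε1 ε2 U P Φ Ψ j) :=
  (((Sm.const _).mul (((hU 0).mul ((hU 0).dd _)).add ((hU 1).mul ((hU 1).dd _)))).add
    ((Sm.const _).mul (Hf_sm _ _ _ _ hΦ hΨ j))).sub
  (((((Sm.const _).mul ((hU 0).sq.add (hU 1).sq)).add hP).add
    ((Sm.const _).mul (Wf_sm _ _ _ _ hΦ hΨ))).mul (hU j))

theorem Ff_per (ρ μ lam : ℝ) {U : Fin 2 → SpT → ℝ} {P : SpT → ℝ} (hU : ∀ i, Per (U i))
    (hP : Per P) (hΦ : Per Φ) (hΨ : Per Ψ) (j : Fin 2) :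
    Per (Ff ρ μ lam γ1 γ2 ε1 ε2 U P Φ Ψ j) := by
  intro m q
  simp only [Ff, Hf, Gf, Wf, hU _ m q, hP m q, hΦ m q, hΨ m q, (hU _).dd _ m q,
    hΦ.dd _ m q, hΨ.dd _ m q]

theorem energy_pt (ρ μ lam M1 M2 : ℝ) {U : Fin 2 → SpT → ℝ} {P : SpT → ℝ} (hU : ∀ i, Sm (U i))
    (hP : Sm P) (hΦ : Sm Φ) (hΨ : Sm Ψ) (q : SpT)
    (hmom : ∀ i, ρ * (DD et (U i) q + (U 0 q * DD (ex 0) (U i) q + U 1 q * DD (ex 1) (U i) q))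
        + DD (ex i) P q
      = lam * (DD (ex 0) (Sf γ1 γ2 ε1 ε2 Φ Ψ i 0) q + DD (ex 1) (Sf γ1 γ2 ε1 ε2 Φ Ψ i 1) q)
        + μ * (DD (ex 0) (DD (ex 0) (U i)) q + DD (ex 1) (DD (ex 1) (U i)) q))
    (hdiv : DD (ex 0) (U 0) q + DD (ex 1) (U 1) q = 0)
    (hφ : DD et Φ q + (U 0 q * DD (ex 0) Φ q + U 1 q * DD (ex 1) Φ q) = -M1 * Af γ1 ε1 Φ Ψ q)
    (hψ : DD et Ψ q + (U 0 q * DD (ex 0) Ψ q + U 1 q * DD (ex 1) Ψ q)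
      = -M2 * Bf γ1 γ2 ε1 ε2 Φ Ψ q) :
    DD et (Ef ρ lam γ1 γ2 ε1 ε2 U Φ Ψ) q =
      (DD (ex 0) (Ff ρ μ lam γ1 γ2 ε1 ε2 U P Φ Ψ 0) q
        + DD (ex 1) (Ff ρ μ lam γ1 γ2 ε1 ε2 U P Φ Ψ 1) q)
      - (μ * ((DD (ex 0) (U 0) q ^ 2 + DD (ex 1) (U 0) q ^ 2)
          + (DD (ex 0) (U 1) q ^ 2 + DD (ex 1) (U 1) q ^ 2))
        + lam * M1 * Af γ1 ε1 Φ Ψ q ^ 2 + lam * M2 * Bf γ1 γ2 ε1 ε2 Φ Ψ q ^ 2) := by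
  have hW := Wf_sm γ1 γ2 ε1 ε2 hΦ hΨ
  have hH := Hf_sm γ1 γ2 ε1 ε2 hΦ hΨ
  have hE : DD et (Ef ρ lam γ1 γ2 ε1 ε2 U Φ Ψ) q =
      ρ * (U 0 q * DD et (U 0) q + U 1 q * DD et (U 1) q)
        + lam * DD et (Wf γ1 γ2 ε1 ε2 Φ Ψ) q := by
    unfold Ef
    simp (maxDischargeDepth := 20) only [DD_add, DD_mul, DD_sq, DD_const,
      Sm.add, Sm.mul, Sm.sq, Sm.const, hU, hW]
    ring
  have hF : ∀ (v : SpT) (j : Fin 2), DD v (Ff ρ μ lam γ1 γ2 ε1 ε2 U P Φ Ψ j) q =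
      μ * (DD v (U 0) q * DD (ex j) (U 0) q + U 0 q * DD v (DD (ex j) (U 0)) q
        + DD v (U 1) q * DD (ex j) (U 1) q + U 1 q * DD v (DD (ex j) (U 1)) q)
      + lam * DD v (Hf γ1 γ2 ε1 ε2 Φ Ψ j) q
      - (ρ * (U 0 q * DD v (U 0) q + U 1 q * DD v (U 1) q) + DD v P q
        + lam * DD v (Wf γ1 γ2 ε1 ε2 Φ Ψ) q) * U j q
      - ((ρ / 2) * (U 0 q ^ 2 + U 1 q ^ 2) + P q + lam * Wf γ1 γ2 ε1 ε2 Φ Ψ q)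
        * DD v (U j) q := by
    intro v j
    unfold Ff
    simp (maxDischargeDepth := 20) only [DD_add, DD_sub, DD_mul, DD_sq, DD_const,
      Sm.add, Sm.sub, Sm.mul, Sm.sq, Sm.const, Sm.dd, hU, hW, hH, hP]
    ring
  have m0 := hmom 0
  have m1 := hmom 1
  rw [div_Sf _ _ _ _ hΦ hΨ] at m0 m1
  rw [hE, hF, hF, Wf_time _ _ _ _ hΦ hΨ]
  generalize Af γ1 ε1 Φ Ψ q = A at *
  generalize Bf γ1 γ2 ε1 ε2 Φ Ψ q = B at *
  generalize Wf γ1 γ2 ε1 ε2 Φ Ψ q = w at *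
  linear_combination U 0 q * m0 + U 1 q * m1 + lam * A * hφ + lam * B * hψ
    + ((ρ / 2) * (U 0 q ^ 2 + U 1 q ^ 2) + P q + lam * w) * hdiv

end

/-- Energy dissipation law for the periodic multi-phase hydrodynamic system:
`d𝓔/dt = −∫_Q ( μ|∇u|² + λM₁|δE/δφ|² + λM₂|δE/δψ|² ) dx` on `(0,T)`. -/
theorem stmt5
    (T ρ μ lam M1 M2 γ1 γ2 ε1 ε2 : ℝ)
    (hT : 0 < T) (hρ : 0 < ρ) (hμ : 0 < μ) (hlam : 0 < lam)
    (hM1 : 0 < M1) (hM2 : 0 < M2)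
    (hγ1 : 0 < γ1) (hγ2 : 0 < γ2) (hε1 : 0 < ε1) (hε2 : 0 < ε2)
    (u : ℝ → (Fin 2 → ℝ) → Fin 2 → ℝ) (p φ ψ : ℝ → (Fin 2 → ℝ) → ℝ)
    (hu : ContDiff ℝ (⊤ : ℕ∞) (fun q : ℝ × (Fin 2 → ℝ) => u q.1 q.2))
    (hp : ContDiff ℝ (⊤ : ℕ∞) (fun q : ℝ × (Fin 2 → ℝ) => p q.1 q.2))
    (hφ : ContDiff ℝ (⊤ : ℕ∞) (fun q : ℝ × (Fin 2 → ℝ) => φ q.1 q.2))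
    (hψ : ContDiff ℝ (⊤ : ℕ∞) (fun q : ℝ × (Fin 2 → ℝ) => ψ q.1 q.2))
    (huper : ∀ (t : ℝ) (x : Fin 2 → ℝ) (m : Fin 2 → ℤ),
      u t (x + fun i => (m i : ℝ)) = u t x)
    (hpper : ∀ (t : ℝ) (x : Fin 2 → ℝ) (m : Fin 2 → ℤ),
      p t (x + fun i => (m i : ℝ)) = p t x)
    (hφper : ∀ (t : ℝ) (x : Fin 2 → ℝ) (m : Fin 2 → ℤ),
      φ t (x + fun i => (m i : ℝ)) = φ t x)
    (hψper : ∀ (t : ℝ) (x : Fin 2 → ℝ) (m : Fin 2 → ℤ),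
      ψ t (x + fun i => (m i : ℝ)) = ψ t x)
    -- momentum equation: ρ(u_t + u·∇u) + ∇p = λ∇·σ̃ᵉ + μΔu
    (hmom : ∀ t ∈ Set.Icc (0 : ℝ) T, ∀ (x : Fin 2 → ℝ) (i : Fin 2),
      ρ * (deriv (fun s => u s x i) t + ∑ j, u t x j * pd j (fun y => u t y i) x)
          + pd i (p t) x
        = lam * (∑ j, pd j (fun y => sigmaE γ1 γ2 ε1 ε2 (φ t) (ψ t) y i j) x)
          + μ * ∑ j, pd j (fun y => pd j (fun z => u t z i) y) x)
    -- incompressibility: ∇·u = 0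
    (hdiv : ∀ t ∈ Set.Icc (0 : ℝ) T, ∀ x : Fin 2 → ℝ,
      ∑ j, pd j (fun y => u t y j) x = 0)
    -- phase field equations
    (hφeq : ∀ t ∈ Set.Icc (0 : ℝ) T, ∀ x : Fin 2 → ℝ,
      deriv (fun s => φ s x) t + ∑ j, u t x j * pd j (φ t) x
        = -M1 * dEdφ γ1 ε1 (φ t) (ψ t) x)
    (hψeq : ∀ t ∈ Set.Icc (0 : ℝ) T, ∀ x : Fin 2 → ℝ,
      deriv (fun s => ψ s x) t + ∑ j, u t x j * pd j (ψ t) x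
        = -M2 * dEdψ γ1 γ2 ε1 ε2 (φ t) (ψ t) x) :
    ∀ t ∈ Set.Ioo (0 : ℝ) T,
      HasDerivAt
        (fun s => ∫ x in Q,
          ((ρ / 2) * ∑ i, (u s x i) ^ 2 + lam * W γ1 γ2 ε1 ε2 (φ s) (ψ s) x))
        (-∫ x in Q,
          (μ * ∑ i, ∑ j, (pd j (fun y => u t y i) x) ^ 2
            + lam * M1 * (dEdφ γ1 ε1 (φ t) (ψ t) x) ^ 2
            + lam * M2 * (dEdψ γ1 γ2 ε1 ε2 (φ t) (ψ t) x) ^ 2))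
        t := by
  intro t ht
  have htI : t ∈ Set.Icc (0 : ℝ) T := ⟨ht.1.le, ht.2.le⟩
  obtain ⟨U, hUdef⟩ : ∃ U : Fin 2 → SpT → ℝ, U = fun i q => u q.1 q.2 i := ⟨_, rfl⟩
  obtain ⟨P, hPdef⟩ : ∃ P : SpT → ℝ, P = fun q => p q.1 q.2 := ⟨_, rfl⟩
  obtain ⟨Φ, hΦdef⟩ : ∃ Φ : SpT → ℝ, Φ = fun q => φ q.1 q.2 := ⟨_, rfl⟩
  obtain ⟨Ψ, hΨdef⟩ : ∃ Ψ : SpT → ℝ, Ψ = fun q => ψ q.1 q.2 := ⟨_, rfl⟩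
  have hU : ∀ i, Sm (U i) := fun i => by rw [hUdef]; exact contDiff_pi.1 hu i
  have hP : Sm P := by rw [hPdef]; exact hp
  have hΦ : Sm Φ := by rw [hΦdef]; exact hφ
  have hΨ : Sm Ψ := by rw [hΨdef]; exact hψ
  have pU : ∀ i, Per (U i) := fun i m q => by
    simp only [hUdef, Prod.fst_add, Prod.snd_add, add_zero, huper]
  have pP : Per P := fun m q => by
    simp only [hPdef, Prod.fst_add, Prod.snd_add, add_zero, hpper]
  have pΦ : Per Φ := fun m q => by
    simp only [hΦdef, Prod.fst_add, Prod.snd_add, add_zero, hφper]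
  have pΨ : Per Ψ := fun m q => by
    simp only [hΨdef, Prod.fst_add, Prod.snd_add, add_zero, hψper]
  have eu : ∀ s x i, u s x i = U i (s, x) := fun s x i => by rw [hUdef]
  have ep : ∀ s, p s = fun y => P (s, y) := fun s => by rw [hPdef]
  have eφ : ∀ s, φ s = fun y => Φ (s, y) := fun s => by rw [hΦdef]
  have eψ : ∀ s, ψ s = fun y => Ψ (s, y) := fun s => by rw [hΨdef]
  have eW : ∀ s x, W γ1 γ2 ε1 ε2 (φ s) (ψ s) x = Wf γ1 γ2 ε1 ε2 Φ Ψ (s, x) := by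
    intro s x
    rw [eφ, eψ]
    simp only [W, Wf, Fin.sum_univ_two, pd_eq hΦ, pd_eq hΨ]
  have eA : ∀ s x, dEdφ γ1 ε1 (φ s) (ψ s) x = Af γ1 ε1 Φ Ψ (s, x) := by
    intro s x
    rw [eφ, eψ]
    have h : ∀ j, pd j (fun y => ((Ψ (s, y) - 1) / 2) ^ 2 * DD (ex j) Φ (s, y)) x
      = DD (ex j) (Gf Φ Ψ j) (s, x) := fun j => pd_eq (Gf_sm hΦ hΨ j) j s x
    simp only [dEdφ, Af, Fin.sum_univ_two, pd_eq hΦ, h]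
  have eB : ∀ s x, dEdψ γ1 γ2 ε1 ε2 (φ s) (ψ s) x = Bf γ1 γ2 ε1 ε2 Φ Ψ (s, x) := by
    intro s x
    rw [eφ, eψ]
    simp only [dEdψ, Bf, Fin.sum_univ_two, pd_eq hΦ, pd_eq hΨ, pd_eq (hΨ.dd _)]
  have eS : ∀ s x i j, pd j (fun y => sigmaE γ1 γ2 ε1 ε2 (φ s) (ψ s) y i j) x
      = DD (ex j) (Sf γ1 γ2 ε1 ε2 Φ Ψ i j) (s, x) := by
    intro s x i j
    rw [eφ, eψ, ← pd_eq (Sf_sm _ _ _ _ hΦ hΨ i j)]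
    simp only [sigmaE, Sf, pd_eq hΦ, pd_eq hΨ]
  have eE : ∀ s x, (ρ / 2) * ∑ i, (u s x i) ^ 2 + lam * W γ1 γ2 ε1 ε2 (φ s) (ψ s) x
      = Ef ρ lam γ1 γ2 ε1 ε2 U Φ Ψ (s, x) := by
    intro s x
    simp only [Fin.sum_univ_two, eu, eW, Ef]
  have key : ∀ x, DD et (Ef ρ lam γ1 γ2 ε1 ε2 U Φ Ψ) (t, x) =
      (DD (ex 0) (Ff ρ μ lam γ1 γ2 ε1 ε2 U P Φ Ψ 0) (t, x)
        + DD (ex 1) (Ff ρ μ lam γ1 γ2 ε1 ε2 U P Φ Ψ 1) (t, x))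
      - (μ * ∑ i, ∑ j, (pd j (fun y => u t y i) x) ^ 2
            + lam * M1 * (dEdφ γ1 ε1 (φ t) (ψ t) x) ^ 2
            + lam * M2 * (dEdψ γ1 γ2 ε1 ε2 (φ t) (ψ t) x) ^ 2) := by
    intro x
    have h1 := hmom t htI x
    have h2 := hdiv t htI x
    have h3 := hφeq t htI x
    have h4 := hψeq t htI x
    simp only [eS] at h1
    simp only [eA] at h3
    simp only [eB] at h4
    simp only [eu, ep, Fin.sum_univ_two, pd_eq (hU _), pd_eq hP, pd_eq ((hU _).dd _),
      deriv_time_eq (hU _)] at h1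
    simp only [eu, Fin.sum_univ_two, pd_eq (hU _)] at h2
    simp only [eu, eφ, Fin.sum_univ_two, pd_eq hΦ, deriv_time_eq hΦ] at h3
    simp only [eu, eψ, Fin.sum_univ_two, pd_eq hΨ, deriv_time_eq hΨ] at h4
    rw [energy_pt γ1 γ2 ε1 ε2 ρ μ lam M1 M2 hU hP hΦ hΨ (t, x) h1 h2 h3 h4]
    simp only [eA, eB]
    simp only [eu, Fin.sum_univ_two, pd_eq (hU _)]
  have hFs := Ff_sm γ1 γ2 ε1 ε2 ρ μ lam hU hP hΦ hΨ
  have hFp := Ff_per γ1 γ2 ε1 ε2 ρ μ lam pU pP pΦ pΨ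
  have hEs := Ef_sm γ1 γ2 ε1 ε2 ρ lam hU hΦ hΨ
  simp only [eE]
  have hD := hasDeriv_int hEs t
  convert hD using 1
  have hz := int_dd_zero hFs hFp t
  have i1 : IntegrableOn (fun x => DD (ex 0) (Ff ρ μ lam γ1 γ2 ε1 ε2 U P Φ Ψ 0) (t, x)
        + DD (ex 1) (Ff ρ μ lam γ1 γ2 ε1 ε2 U P Φ Ψ 1) (t, x)) Q volume :=
    (intOn ((hFs 0).dd _).cont t).add (intOn ((hFs 1).dd _).cont t)
  have i2 := intOn (hEs.dd et).cont t
  have h5 := integral_sub i1 i2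
  rw [hz, zero_sub] at h5
  rw [← neg_inj, neg_neg, ← h5]
  refine integral_congr_ae (Filter.Eventually.of_forall fun x => ?_)
  simp only [key x]
  ring
end
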